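/- Let k ≥ 1 and let b, c be positive integers. The following two conditions are equivalent: (1) there exist nonnegative integers l_1,...,l_k and an integer P > 1 such that there is a c-multitiling of ℤ/Pℤ with tile u_{l_1,...,l_k;b,c;P}; (2) for every prime q and every positive integer t with q^t dividing (b+c)/gcd(b,c), it holds that b + c ≤ 2k + (b+c)/q^t. -/

import Mathlib

open Polynomial

open scoped Classical

/-- The product of the cyclotomic polynomials `Φ_n` over all `n ∣ P` such that `n` is a
prime power and `Φ_n` divides `A` (the polynomial `S̃_P` / `d̃_u` of the paper). -/
noncomputable def cycloProdPP (P : ℕ) (A : Polynomial ℤ) : Polynomial ℤ :=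
  ∏ n ∈ (Nat.divisors P).filter
      (fun n => IsPrimePow n ∧ Polynomial.cyclotomic n ℤ ∣ A),
    Polynomial.cyclotomic n ℤ

/-- The polynomial `A(x) = (b+c-2k)·x^M + Σ_i (x^{M+l_i} + x^{M-l_i})`, where
`M = max(l_1,...,l_k)`. -/
noncomputable def polyA (k : ℕ) (l : Fin k → ℕ) (b c : ℕ) : Polynomial ℤ :=
  Polynomial.C ((b : ℤ) + (c : ℤ) - 2 * (k : ℤ)) * Polynomial.X ^ (Finset.univ.sup l)
    + ∑ i : Fin k,
      (Polynomial.X ^ (Finset.univ.sup l + l i) + Polynomial.X ^ (Finset.univ.sup l - l i))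

/-- A perfect 2-colouring (black = `true`, white = `false`) with parameters `(b, c)` of the
circulant graph `C_P(l_1,...,l_k)` on `ℤ/Pℤ`: every black vertex has exactly `b` white
neighbours and every white vertex has exactly `c` black neighbours, counted with
multiplicity. -/
def IsPerfectColouring (P k : ℕ) (l : Fin k → ℕ) (b c : ℕ) (f : ZMod P → Bool) : Prop :=
  (∀ v : ZMod P, f v = true →
    (∑ i : Fin k, ((if f (v + (l i : ZMod P)) = false then 1 else 0)
      + (if f (v - (l i : ZMod P)) = false then 1 else 0)) = b)) ∧
  (∀ v : ZMod P, f v = false →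
    (∑ i : Fin k, ((if f (v + (l i : ZMod P)) = true then 1 else 0)
      + (if f (v - (l i : ZMod P)) = true then 1 else 0)) = c))

/-- A perfect 2-colouring (black = `true`, white = `false`) with parameters `(b, c)` of the
infinite circulant graph `C_∞(l_1,...,l_k)` on `ℤ`. -/
def IsPerfectColouringInt (k : ℕ) (l : Fin k → ℕ) (b c : ℕ) (f : ℤ → Bool) : Prop :=
  (∀ n : ℤ, f n = true →
    (∑ i : Fin k, ((if f (n + (l i : ℤ)) = false then 1 else 0)
      + (if f (n - (l i : ℤ)) = false then 1 else 0)) = b)) ∧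
  (∀ n : ℤ, f n = false →
    (∑ i : Fin k, ((if f (n + (l i : ℤ)) = true then 1 else 0)
      + (if f (n - (l i : ℤ)) = true then 1 else 0)) = c))

/-- `v` is an `m`-multitiling of `ℤ/Pℤ` with tile `u`:
`Σ_{h ∈ ℤ/Pℤ} u(g-h)·v(h) = m` for every `g` (the residues `0,…,P-1` enumerate `ℤ/Pℤ`,
so we sum over `Finset.range P`). -/
def IsMultitiling (P : ℕ) (u v : ZMod P → ℤ) (m : ℤ) : Prop :=
  ∀ g : ZMod P, ∑ a ∈ Finset.range P, u (g - (a : ZMod P)) * v ((a : ZMod P)) = m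

/-- The tile `u_{l_1,...,l_k;b,c;P}(h) = (b+c-2k)·δ_M(h) + Σ_i (δ_{M+l_i}(h) + δ_{M-l_i}(h))`
on `ℤ/Pℤ`, where `M = max(l_1,...,l_k)`. -/
def tileU (P k : ℕ) (l : Fin k → ℕ) (b c : ℕ) : ZMod P → ℤ :=
  fun h =>
    ((b : ℤ) + (c : ℤ) - 2 * (k : ℤ)) * (if ((Finset.univ.sup l : ℕ) : ZMod P) = h then 1 else 0)
      + ∑ i : Fin k,
        ((if ((Finset.univ.sup l + l i : ℕ) : ZMod P) = h then 1 else 0)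
          + (if ((Finset.univ.sup l - l i : ℕ) : ZMod P) = h then 1 else 0))

/-- The mask polynomial `Q_u(x) = Σ_{a=0}^{P-1} u(a)·x^a` of a tile `u : ℤ/Pℤ → ℤ`. -/
noncomputable def maskPoly (P : ℕ) (u : ZMod P → ℤ) : Polynomial ℤ :=
  ∑ a ∈ Finset.range P, Polynomial.C (u (a : ZMod P)) * Polynomial.X ^ a

/-! ### Tilings and the shift operator -/

/-- The translation operator `f ↦ f (· - 1)` on functions on `ℤ/Pℤ`. -/
def shift (P : ℕ) : Module.End ℤ (ZMod P → ℤ) :=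
  LinearMap.funLeft ℤ ℤ (fun g => g - 1)

lemma shift_pow_apply (P n : ℕ) (f : ZMod P → ℤ) (g : ZMod P) :
    (shift P ^ n) f g = f (g - n) := by
  induction n generalizing g with
  | zero => simp
  | succ n ih =>
    rw [pow_succ', Module.End.mul_apply]
    change (shift P ^ n) f (g - 1) = _
    rw [ih]
    push_cast
    congr 1
    ring

lemma sum_range_natCast_zmod {M : Type*} [AddCommMonoid M] (P : ℕ) [NeZero P]
    (F : ZMod P → M) : ∑ a ∈ Finset.range P, F (a : ZMod P) = ∑ h : ZMod P, F h := by
  refine Finset.sum_nbij' (fun a => (a : ZMod P)) ZMod.val ?_ ?_ ?_ ?_ ?_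
  · simp
  · intro h _
    simpa using ZMod.val_lt h
  · intro a ha
    exact ZMod.val_cast_of_lt (Finset.mem_range.mp ha)
  · simp
  · simp

lemma sum_tileU_mul (P k : ℕ) [NeZero P] (l : Fin k → ℕ) (b c : ℕ) (v : ZMod P → ℤ)
    (g : ZMod P) :
    ∑ a ∈ Finset.range P, tileU P k l b c (g - (a : ZMod P)) * v (a : ZMod P) =
      aeval (shift P) (polyA k l b c) v g := by
  have key : ∀ n : ℕ, ∑ h : ZMod P, (if (n : ZMod P) = g - h then 1 else 0) * v h =
      v (g - n) := by
    intro n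
    rw [Finset.sum_eq_single (g - n)]
    · simp
    · intro h _ hne
      rw [if_neg, zero_mul]
      rintro hn
      exact hne (by rw [hn]; ring)
    · simp
  rw [sum_range_natCast_zmod P (fun h => tileU P k l b c (g - h) * v h)]
  simp only [tileU, add_mul, Finset.sum_add_distrib, Finset.sum_mul]
  rw [Finset.sum_comm, Finset.sum_comm (t := (Finset.univ : Finset (Fin k)))]
  simp only [mul_assoc, ← Finset.mul_sum, key, polyA, map_add, map_sum, map_mul, map_pow,
    aeval_X, LinearMap.add_apply, LinearMap.sum_apply, Pi.add_apply, Finset.sum_apply,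
    shift_pow_apply, Module.End.mul_apply, aeval_C, Module.algebraMap_end_apply, Pi.smul_apply,
    smul_eq_mul, Finset.sum_add_distrib]

lemma isMultitiling_tileU_iff (P k : ℕ) [NeZero P] (l : Fin k → ℕ) (b c : ℕ)
    (v : ZMod P → ℤ) (m : ℤ) :
    IsMultitiling P (tileU P k l b c) v m ↔
      ∀ g, aeval (shift P) (polyA k l b c) v g = m := by
  simp only [IsMultitiling, sum_tileU_mul]

/-! ### Evaluation of mask polynomials at roots of unity -/

lemma aeval_maskPoly {A : Type*} [CommRing A] (P : ℕ) (f : ZMod P → ℤ) (z : A) :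
    aeval z (maskPoly P f) = ∑ a ∈ Finset.range P, (f a : A) * z ^ a := by
  simp [maskPoly]

lemma aeval_maskPoly_shift {A : Type*} [CommRing A] (P : ℕ) [NeZero P] {z : A}
    (hz : z ^ P = 1) (f : ZMod P → ℤ) :
    aeval z (maskPoly P (shift P f)) = z * aeval z (maskPoly P f) := by
  have hsum : ∀ f : ZMod P → ℤ,
      aeval z (maskPoly P f) = ∑ h : ZMod P, (f h : A) * z ^ h.val := by
    intro f
    rw [aeval_maskPoly, ← sum_range_natCast_zmod P (fun h => (f h : A) * z ^ h.val)]
    refine Finset.sum_congr rfl fun a ha => ?_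
    rw [ZMod.val_cast_of_lt (Finset.mem_range.mp ha)]
  rw [hsum, hsum, Finset.mul_sum, ← Equiv.sum_comp (Equiv.addRight (1 : ZMod P))]
  refine Finset.sum_congr rfl fun h _ => ?_
  have hs : shift P f (h + 1) = f h := by
    change f (h + 1 - 1) = f h
    rw [add_sub_cancel_right]
  have hone : z ^ (h + 1).val = z ^ h.val * z := by
    rw [ZMod.val_add, ZMod.val_one_eq_one_mod, Nat.add_mod_mod, ← pow_succ]
    conv_rhs => rw [← Nat.div_add_mod (h.val + 1) P, pow_add, pow_mul, hz, one_pow, one_mul]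
  rw [Equiv.coe_addRight, hs, hone]
  ring

lemma maskPoly_add (P : ℕ) (f g : ZMod P → ℤ) :
    maskPoly P (f + g) = maskPoly P f + maskPoly P g := by
  simp [maskPoly, add_mul, Finset.sum_add_distrib]

lemma maskPoly_smul (P : ℕ) (n : ℤ) (f : ZMod P → ℤ) :
    maskPoly P (n • f) = C n * maskPoly P f := by
  simp [maskPoly, Finset.mul_sum, mul_assoc]

lemma aeval_maskPoly_aeval_shift {A : Type*} [CommRing A] (P : ℕ) [NeZero P] {z : A}
    (hz : z ^ P = 1) (U : ℤ[X]) (f : ZMod P → ℤ) :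
    aeval z (maskPoly P (aeval (shift P) U f)) = aeval z U * aeval z (maskPoly P f) := by
  induction U using Polynomial.induction_on generalizing f with
  | C n => rw [aeval_C, Module.algebraMap_end_apply, maskPoly_smul, map_mul, aeval_C]
  | add p q hp hq =>
    rw [map_add, LinearMap.add_apply, maskPoly_add, map_add, hp, hq, map_add, add_mul]
  | monomial n a ih =>
    rw [pow_succ, ← mul_assoc, map_mul, Module.End.mul_apply, ih, aeval_X,
      aeval_maskPoly_shift P hz, map_mul _ (C a * X ^ n), aeval_X, mul_assoc]

/-- A multitiling satisfies `U(z) V(z) = m (1 + z + ⋯ + z^{P-1})` at all `z` with `z^P = 1`. -/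
lemma IsMultitiling.aeval_mul {A : Type*} [CommRing A] {P k : ℕ} [NeZero P] {l : Fin k → ℕ}
    {b c : ℕ} {v : ZMod P → ℤ} {m : ℤ} (h : IsMultitiling P (tileU P k l b c) v m) {z : A}
    (hz : z ^ P = 1) :
    aeval z (polyA k l b c) * aeval z (maskPoly P v) = m * ∑ a ∈ Finset.range P, z ^ a := by
  rw [isMultitiling_tileU_iff] at h
  rw [← aeval_maskPoly_aeval_shift P hz, aeval_maskPoly, Finset.mul_sum]
  simp [h]

/-! ### Divisibility by cyclotomic polynomials -/

lemma cyclotomic_dvd_iff_aeval_eq_zero {n : ℕ} (hn : 0 < n) {z : ℂ} (hz : IsPrimitiveRoot z n)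
    (U : ℤ[X]) : cyclotomic n ℤ ∣ U ↔ aeval z U = 0 := by
  rw [cyclotomic_eq_minpoly hz hn]
  constructor
  · rintro ⟨V, rfl⟩
    simp
  · exact minpoly.isIntegrallyClosed_dvd (hz.isIntegral hn)

lemma prod_cyclotomic_dvd {S : Finset ℕ} (hS : ∀ n ∈ S, 0 < n) {U : ℤ[X]}
    (h : ∀ n ∈ S, cyclotomic n ℤ ∣ U) : ∏ n ∈ S, cyclotomic n ℤ ∣ U := by
  refine Finset.prod_dvd_of_isRelPrime (fun m hm n hn hmn => ?_) h
  rw [Function.onFun, (cyclotomic.irreducible (hS m hm)).isRelPrime_iff_not_dvd]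
  intro hd
  exact hmn (cyclotomic_injective (R := ℤ) (Polynomial.eq_of_monic_of_associated
    (cyclotomic.monic m ℤ) (cyclotomic.monic n ℤ)
    ((cyclotomic.irreducible (hS m hm)).associated_of_dvd (cyclotomic.irreducible (hS n hn)) hd)))

lemma eval_one_polyA (k : ℕ) (l : Fin k → ℕ) (b c : ℕ) :
    eval 1 (polyA k l b c) = b + c := by
  simp [polyA, eval_finsetSum]
  ring

/-- The symmetric Laurent polynomial `b + c - 2k + ∑ i, (z^{l_i} + z^{-l_i})`. -/
noncomputable def symSum (k : ℕ) (l : Fin k → ℕ) (b c : ℕ) (z : ℂ) : ℂ :=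
  (b + c - 2 * k) + ∑ i, (z ^ l i + z⁻¹ ^ l i)

lemma aeval_polyA (k : ℕ) (l : Fin k → ℕ) (b c : ℕ) {z : ℂ} (hz : z ≠ 0) :
    aeval z (polyA k l b c) = z ^ Finset.univ.sup l * symSum k l b c z := by
  have h : ∀ i, z ^ (Finset.univ.sup l - l i) = z ^ Finset.univ.sup l * z⁻¹ ^ l i := by
    intro i
    rw [inv_pow, pow_sub₀ z hz (Finset.le_sup (Finset.mem_univ i))]
  have h2 : aeval z (2 : ℤ[X]) = 2 := map_ofNat _ 2
  simp [polyA, symSum, h, h2, pow_add, mul_add, Finset.mul_sum]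
  ring

lemma cyclotomic_dvd_polyA_iff {n : ℕ} (hn : 0 < n) {z : ℂ} (hz : IsPrimitiveRoot z n)
    (k : ℕ) (l : Fin k → ℕ) (b c : ℕ) :
    cyclotomic n ℤ ∣ polyA k l b c ↔ symSum k l b c z = 0 := by
  have h0 : z ≠ 0 := hz.ne_zero hn.ne'
  rw [cyclotomic_dvd_iff_aeval_eq_zero hn hz, aeval_polyA k l b c h0]
  simp [h0]

/-! ### Multitilings force the arithmetic condition -/

/-- The total coefficient of the exponents divisible by `n` in the symmetric Laurent polynomial
`b + c - 2k + ∑ i, (x^{l_i} + x^{-l_i})`. -/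
noncomputable def multiplesMass (k : ℕ) (l : Fin k → ℕ) (b c n : ℕ) : ℤ :=
  b + c - 2 * k + 2 * (Finset.univ.filter fun i => n ∣ l i).card

lemma IsPrimitiveRoot.sum_pow_pow {z : ℂ} {n : ℕ} (hz : IsPrimitiveRoot z n) (m : ℕ) :
    ∑ a ∈ Finset.range n, (z ^ a) ^ m = if n ∣ m then (n : ℂ) else 0 := by
  have hcomm : ∀ a, (z ^ a) ^ m = (z ^ m) ^ a := fun a => by rw [← pow_mul, ← pow_mul, mul_comm]
  simp only [hcomm]
  split_ifs with h
  · simp [(hz.pow_eq_one_iff_dvd m).2 h]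
  · have hne : z ^ m ≠ 1 := fun h1 => h ((hz.pow_eq_one_iff_dvd m).1 h1)
    have := mul_geom_sum (z ^ m) n
    rw [← pow_mul, mul_comm m n, pow_mul, hz.pow_eq_one, one_pow, sub_self] at this
    exact (mul_eq_zero.mp this).resolve_left (sub_ne_zero.mpr hne)

lemma sum_symSum_pow (k : ℕ) (l : Fin k → ℕ) (b c : ℕ) {z : ℂ} {n : ℕ}
    (hz : IsPrimitiveRoot z n) :
    ∑ a ∈ Finset.range n, symSum k l b c (z ^ a) = n * (multiplesMass k l b c n : ℂ) := by
  have hinv : ∀ a, (z ^ a)⁻¹ = z⁻¹ ^ a := fun a => (inv_pow z a).symm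
  simp only [symSum, hinv, Finset.sum_add_distrib]
  rw [Finset.sum_comm, Finset.sum_comm (t := (Finset.univ : Finset (Fin k)))]
  simp only [hz.sum_pow_pow, hz.inv.sum_pow_pow, ← Finset.sum_filter]
  simp [multiplesMass]
  ring

lemma mul_multiplesMass (k : ℕ) (l : Fin k → ℕ) (b c : ℕ) {q : ℕ} (hq : q.Prime) (j : ℕ)
    (h : ∀ z : ℂ, IsPrimitiveRoot z (q ^ (j + 1)) → symSum k l b c z = 0) :
    q * multiplesMass k l b c (q ^ (j + 1)) = multiplesMass k l b c (q ^ j) := by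
  have hpos : 0 < q ^ (j + 1) := pow_pos hq.pos _
  have hz := Complex.isPrimitiveRoot_exp (q ^ (j + 1)) hpos.ne'
  set z := Complex.exp (2 * Real.pi * Complex.I / (q ^ (j + 1) : ℕ))
  have hzq : IsPrimitiveRoot (z ^ q) (q ^ j) := hz.pow hpos (pow_succ' q j)
  have h1 := sum_symSum_pow k l b c hz
  have h2 := sum_symSum_pow k l b c hzq
  have hsum : ∑ a ∈ Finset.range (q ^ (j + 1)), symSum k l b c (z ^ a) =
      ∑ a ∈ Finset.range (q ^ j), symSum k l b c ((z ^ q) ^ a) := by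
    rw [← Finset.sum_subset (s₁ := (Finset.range (q ^ j)).image (q * ·))]
    · rw [Finset.sum_image fun x _ y _ hxy => Nat.eq_of_mul_eq_mul_left hq.pos hxy]
      simp only [pow_mul]
    · intro a ha
      obtain ⟨d, hd, rfl⟩ := Finset.mem_image.mp ha
      rw [Finset.mem_range, pow_succ']
      exact Nat.mul_lt_mul_of_pos_left (Finset.mem_range.mp hd) hq.pos
    · intro a ha hna
      refine h _ (hz.pow_of_coprime a (Nat.Coprime.pow_right _ ?_))
      rw [Nat.coprime_comm, hq.coprime_iff_not_dvd]
      rintro ⟨d, rfl⟩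
      refine hna (Finset.mem_image_of_mem _ (Finset.mem_range.mpr ?_))
      rw [Finset.mem_range, pow_succ'] at ha
      exact Nat.lt_of_mul_lt_mul_left ha
  rw [h1, h2, pow_succ] at hsum
  have hne : (q ^ j : ℂ) ≠ 0 := pow_ne_zero _ (Nat.cast_ne_zero.mpr hq.ne_zero)
  push_cast at hsum
  rw [mul_assoc] at hsum
  exact_mod_cast mul_left_cancel₀ hne hsum

lemma multiplesMass_anti (k : ℕ) (l : Fin k → ℕ) (b c : ℕ) {m n : ℕ} (h : m ∣ n) :
    multiplesMass k l b c n ≤ multiplesMass k l b c m := by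
  have : (Finset.univ.filter fun i => n ∣ l i).card ≤ (Finset.univ.filter fun i => m ∣ l i).card :=
    Finset.card_le_card fun i hi => by
      simp only [Finset.mem_filter, Finset.mem_univ, true_and] at hi ⊢
      exact h.trans hi
  unfold multiplesMass
  gcongr

lemma pow_card_mul_multiplesMass_le (k : ℕ) (l : Fin k → ℕ) (b c : ℕ) {q : ℕ} (hq : q.Prime)
    (N : ℕ) :
    (q : ℤ) ^ ((Finset.range N).filter
      fun j => cyclotomic (q ^ (j + 1)) ℤ ∣ polyA k l b c).card *
        multiplesMass k l b c (q ^ N) ≤ b + c := by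
  induction N with
  | zero => simp [multiplesMass]
  | succ N ih =>
    rw [Finset.range_add_one, Finset.filter_insert]
    split_ifs with h
    · rw [Finset.card_insert_of_notMem (by simp), pow_succ, mul_assoc,
        mul_multiplesMass k l b c hq N fun z hz =>
          (cyclotomic_dvd_polyA_iff (pow_pos hq.pos _) hz k l b c).1 h]
      exact ih
    · refine le_trans ?_ ih
      gcongr
      exact multiplesMass_anti k l b c (pow_dvd_pow q N.le_succ)

lemma pow_card_dvd_eval_one {q : ℕ} (hq : q.Prime) {S : Finset ℕ} {V : ℤ[X]}
    (h : ∀ j ∈ S, cyclotomic (q ^ (j + 1)) ℤ ∣ V) : (q : ℤ) ^ S.card ∣ eval 1 V := by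
  have := Fact.mk hq
  have hinj : Set.InjOn (fun j => q ^ (j + 1)) (S : Set ℕ) := fun i _ j _ hij =>
    Nat.succ_injective (Nat.pow_right_injective hq.two_le hij)
  have hd : ∏ n ∈ S.image (fun j => q ^ (j + 1)), cyclotomic n ℤ ∣ V := by
    refine prod_cyclotomic_dvd ?_ ?_
    · simp [hq.pos]
    · simpa using h
  rw [Finset.prod_image hinj] at hd
  have := eval_dvd (x := (1 : ℤ)) hd
  rwa [eval_prod, Finset.prod_congr rfl fun j _ => eval_one_cyclotomic_prime_pow j,
    Finset.prod_const] at this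

lemma coprime_add_div_gcd {b c : ℕ} (hc : 0 < c) :
    Nat.Coprime ((b + c) / Nat.gcd b c) (c / Nat.gcd b c) := by
  have hg : Nat.gcd (b + c) c = Nat.gcd b c := by simp
  rw [← hg]
  exact Nat.coprime_div_gcd_div_gcd (hg ▸ Nat.gcd_pos_of_pos_right b hc)

lemma IsMultitiling.add_le {P k : ℕ} (hP : 1 < P) {l : Fin k → ℕ} {b c : ℕ} (hc : 0 < c)
    {v : ZMod P → ℤ} (h : IsMultitiling P (tileU P k l b c) v c) {q t : ℕ} (hq : q.Prime)
    (hqt : q ^ t ∣ (b + c) / Nat.gcd b c) : b + c ≤ 2 * k + (b + c) / q ^ t := by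
  have : NeZero P := ⟨by omega⟩
  set g := Nat.gcd b c
  have hg : 0 < g := Nat.gcd_pos_of_pos_right b hc
  obtain ⟨d, hd⟩ : g ∣ b + c := (Nat.dvd_add (Nat.gcd_dvd_left b c) (Nat.gcd_dvd_right b c))
  obtain ⟨e, he⟩ : g ∣ c := Nat.gcd_dvd_right b c
  have hcop : Nat.Coprime d e := by
    have := coprime_add_div_gcd (b := b) hc
    change Nat.Coprime ((b + c) / g) (c / g) at this
    rwa [hd, Nat.mul_div_cancel_left _ hg, he, Nat.mul_div_cancel_left _ hg] at this
  rw [hd, Nat.mul_div_cancel_left _ hg] at hqt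
  -- comparing values at `1`
  have hone : (d : ℤ) * eval 1 (maskPoly P v) = e * P := by
    have := h.aeval_mul (one_pow P : (1 : ℤ) ^ P = 1)
    simp only [coe_aeval_eq_eval, eval_one_polyA, one_pow, Finset.sum_const, Finset.card_range,
      nsmul_eq_mul, mul_one, Int.cast_id] at this
    have hd' : (b : ℤ) + c = g * d := by exact_mod_cast hd
    have he' : (c : ℤ) = g * e := by exact_mod_cast he
    rw [hd', he', mul_assoc, mul_assoc] at this
    exact mul_left_cancel₀ (by exact_mod_cast hg.ne') this
  set N := P.factorization q
  set J := (Finset.range N).filter fun j => cyclotomic (q ^ (j + 1)) ℤ ∣ polyA k l b c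
  set K := (Finset.range N).filter fun j => ¬ cyclotomic (q ^ (j + 1)) ℤ ∣ polyA k l b c
  have hcard : J.card + K.card = N := by
    rw [Finset.card_filter_add_card_filter_not, Finset.card_range]
  have hK : (q : ℤ) ^ K.card ∣ eval 1 (maskPoly P v) := by
    refine pow_card_dvd_eval_one hq fun j hj => ?_
    obtain ⟨hjN, hj⟩ := Finset.mem_filter.mp hj
    have hpos : 0 < q ^ (j + 1) := pow_pos hq.pos _
    have hz := Complex.isPrimitiveRoot_exp _ hpos.ne'
    have hdvd : q ^ (j + 1) ∣ P :=
      (pow_dvd_pow q (Finset.mem_range.mp hjN)).trans (Nat.ordProj_dvd P q)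
    have hmul := h.aeval_mul ((hz.pow_eq_one_iff_dvd P).2 hdvd)
    rw [cyclotomic_dvd_iff_aeval_eq_zero hpos hz] at hj ⊢
    refine (mul_eq_zero.mp (hmul.trans ?_)).resolve_left hj
    have hmg := mul_geom_sum (Complex.exp (2 * Real.pi * Complex.I / (q ^ (j + 1) : ℕ))) P
    rw [(hz.pow_eq_one_iff_dvd P).2 hdvd, sub_self] at hmg
    rw [(mul_eq_zero.mp hmg).resolve_left
      (sub_ne_zero.mpr (hz.ne_one (Nat.one_lt_pow j.succ_ne_zero hq.one_lt))), mul_zero]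
  have htJ : t ≤ J.card := by
    have hdvd : q ^ (t + K.card) ∣ e * P := by
      have : ((q ^ (t + K.card) : ℕ) : ℤ) ∣ (e * P : ℕ) := by
        push_cast
        rw [pow_add, ← hone]
        exact mul_dvd_mul (by exact_mod_cast hqt) hK
      exact_mod_cast this
    rcases Nat.eq_zero_or_pos t with rfl | ht
    · exact Nat.zero_le _
    have hqe : Nat.Coprime (q ^ (t + K.card)) e :=
      Nat.Coprime.pow_left _ (Nat.Coprime.coprime_dvd_left ((dvd_pow_self q ht.ne').trans hqt) hcop)
    have := (hq.pow_dvd_iff_le_factorization (NeZero.ne P)).1 (hqe.dvd_of_dvd_mul_left hdvd)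
    omega
  have hbound := pow_card_mul_multiplesMass_le k l b c hq N
  have hqtp : 0 < q ^ t := pow_pos hq.pos t
  by_cases hs : b + c ≤ 2 * k
  · exact hs.trans (Nat.le_add_right _ _)
  have hkey : (b + c - 2 * k) * q ^ t ≤ b + c := by
    zify [(not_le.mp hs).le]
    refine le_trans ?_ hbound
    rw [mul_comm]
    have hle : (q : ℤ) ^ t ≤ q ^ J.card := pow_le_pow_right₀ (by exact_mod_cast hq.one_le) htJ
    have hmass : (b : ℤ) + c - 2 * k ≤ multiplesMass k l b c (q ^ N) := by
      unfold multiplesMass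
      linarith [Int.natCast_nonneg (Finset.univ.filter fun i => q ^ N ∣ l i).card]
    have hnn : (0 : ℤ) ≤ b + c - 2 * k := by omega
    gcongr
  have := (Nat.le_div_iff_mul_le hqtp).2 hkey
  omega

/-! ### Construction of multitilings -/

lemma sum_add_inv_eq {z w : ℂ} (hw : w ≠ 0) {N : ℕ}
    (h : z ^ 2 * w ^ (2 * N) = w) :
    ∑ r ∈ Finset.range N, (z * w ^ r + (z * w ^ r)⁻¹) =
      z * ∑ r ∈ Finset.range (2 * N), w ^ r := by
  rw [two_mul N, Finset.sum_range_add, Finset.sum_add_distrib, mul_add, Finset.mul_sum,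
    Finset.mul_sum, ← Finset.sum_range_reflect (fun r => z * w ^ (N + r))]
  congr 1
  refine Finset.sum_congr rfl fun r hr => inv_eq_of_mul_eq_one_left ?_
  have hr := Finset.mem_range.mp hr
  refine mul_left_cancel₀ hw ?_
  rw [mul_one]
  refine Eq.trans ?_ h
  have he : 2 * N = 1 + r + (N + (N - 1 - r)) := by omega
  rw [he, pow_add, pow_add]
  ring

/-- Exponents whose symmetrized exponential sum, completed to total weight `s`, vanishes at all
roots of unity of order `q^2, …, q^{t+1}`. -/
def HasVanishingExponents (s k q t : ℕ) (L : Multiset ℕ) : Prop :=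
  L.card = k ∧ ∀ i < t, ∀ z : ℂ, IsPrimitiveRoot z (q ^ (i + 2)) →
    (s - 2 * k : ℂ) + (L.map fun n => z ^ n + z⁻¹ ^ n).sum = 0

lemma hasVanishingExponents_pad {s k q t : ℕ} (L : Multiset ℕ) (hL : L.card ≤ k)
    (h : ∀ i < t, ∀ z : ℂ, IsPrimitiveRoot z (q ^ (i + 2)) →
      (L.map fun n => z ^ n + z⁻¹ ^ n).sum = 2 * L.card - s) :
    HasVanishingExponents s k q t (L + Multiset.replicate (k - L.card) 0) := by
  refine ⟨by simp [hL], fun i hi z hz => ?_⟩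
  rw [Multiset.map_add, Multiset.sum_add, h i hi z hz]
  simp [Nat.cast_sub hL]
  ring

lemma pow_geom_sum_eq_zero {q t i : ℕ} (hq : q.Prime) (hi : i < t) {z : ℂ}
    (hz : IsPrimitiveRoot z (q ^ (i + 2))) :
    (z ^ q) ^ q ^ t = 1 ∧ ∑ r ∈ Finset.range (q ^ t), (z ^ q) ^ r = 0 := by
  have hw : IsPrimitiveRoot (z ^ q) (q ^ (i + 1)) := hz.pow (pow_pos hq.pos _) (pow_succ' q _)
  have h1 : (z ^ q) ^ q ^ t = 1 := (hw.pow_eq_one_iff_dvd _).2 (pow_dvd_pow q hi)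
  refine ⟨h1, ?_⟩
  have := mul_geom_sum (z ^ q) (q ^ t)
  rw [h1, sub_self] at this
  exact (mul_eq_zero.mp this).resolve_left
    (sub_ne_zero.mpr (hw.ne_one (Nat.one_lt_pow i.succ_ne_zero hq.one_lt)))

lemma exists_hasVanishingExponents_odd {q t k a : ℕ} (hq : q.Prime) (hodd : Odd q)
    (hs : a * q ^ t ≤ 2 * k + a) : ∃ L, HasVanishingExponents (a * q ^ t) k q t L := by
  obtain ⟨N, hN⟩ : Odd (q ^ t) := hodd.pow
  refine ⟨_, hasVanishingExponents_pad
    (a • (Multiset.range N).map fun r => q * (r + 1)) ?_ ?_⟩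
  · simp
    rw [hN] at hs
    linarith
  · intro i hi z hz
    obtain ⟨h1, hgeom⟩ := pow_geom_sum_eq_zero hq hi hz
    have h0 : z ≠ 0 := hz.ne_zero (pow_pos hq.pos _).ne'
    have hw : z ^ q ≠ 0 := pow_ne_zero _ h0
    have hterm : ∀ r, z ^ (q * (r + 1)) + z⁻¹ ^ (q * (r + 1)) =
        z ^ q * (z ^ q) ^ r + (z ^ q * (z ^ q) ^ r)⁻¹ := by
      intro r
      rw [inv_pow, pow_mul, pow_succ']
    rw [hN] at h1 hgeom
    have hsum := sum_add_inv_eq hw (N := N) (by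
      rw [← pow_add, show 2 + 2 * N = (2 * N + 1) + 1 by ring, pow_succ, h1, one_mul])
    rw [Finset.sum_range_succ', pow_zero] at hgeom
    simp only [pow_succ' (z ^ q), ← Finset.mul_sum] at hgeom
    rw [eq_neg_of_add_eq_zero_left hgeom] at hsum
    rw [Multiset.map_nsmul, Multiset.sum_nsmul, Multiset.map_map]
    simp only [Function.comp_def, hterm]
    rw [show (Multiset.map _ (Multiset.range N)).sum = (-1 : ℂ) from hsum, hN]
    simp
    ring

lemma exists_hasVanishingExponents_two {t k a : ℕ} (ht : 0 < t)
    (hs : a * 2 ^ t ≤ 2 * k + a) : ∃ L, HasVanishingExponents (a * 2 ^ t) k 2 t L := by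
  obtain ⟨N, hN⟩ : ∃ N, 2 ^ t = 2 * (N + 1) := by
    obtain ⟨m, hm⟩ := dvd_pow_self 2 ht.ne'
    have : 0 < 2 ^ t := by positivity
    exact ⟨m - 1, by omega⟩
  refine ⟨_, hasVanishingExponents_pad
    ((a / 2) • (Multiset.range (2 * N + 1)).map (fun r => 2 * (r + 1)) +
      (a % 2) • (Multiset.range (N + 1)).map (fun r => 2 * r + 1)) ?_ ?_⟩
  · simp
    rw [hN] at hs
    have ha := Nat.div_add_mod a 2
    have hlt := Nat.mod_lt a two_pos
    generalize a / 2 = x at *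
    generalize a % 2 = y at *
    subst ha
    nlinarith
  · intro i hi z hz
    obtain ⟨h1, hgeom⟩ := pow_geom_sum_eq_zero Nat.prime_two hi hz
    have h0 : z ≠ 0 := hz.ne_zero (pow_pos two_pos _).ne'
    have hw : z ^ 2 ≠ 0 := pow_ne_zero _ h0
    have hoddterm : ∀ r, z ^ (2 * r + 1) + z⁻¹ ^ (2 * r + 1) =
        z * (z ^ 2) ^ r + (z * (z ^ 2) ^ r)⁻¹ := by
      intro r
      rw [inv_pow, pow_succ', pow_mul]
    rw [hN] at h1 hgeom
    have hoddsum := sum_add_inv_eq hw (N := N + 1) (by rw [h1, mul_one])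
    rw [hgeom, mul_zero] at hoddsum
    have hpos : ∑ r ∈ Finset.range (2 * N + 1), z ^ (2 * (r + 1)) = -1 := by
      rw [show 2 * (N + 1) = 2 * N + 1 + 1 by ring, Finset.sum_range_succ', pow_zero] at hgeom
      simpa only [pow_mul] using eq_neg_of_add_eq_zero_left hgeom
    have hneg : ∑ r ∈ Finset.range (2 * N + 1), z⁻¹ ^ (2 * (r + 1)) = -1 := by
      rw [← hpos, ← Finset.sum_range_reflect]
      refine Finset.sum_congr rfl fun r hr => ?_
      have hr := Finset.mem_range.mp hr
      rw [inv_pow]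
      refine inv_eq_of_mul_eq_one_left ?_
      rw [← pow_add, ← h1, ← pow_mul]
      congr 1
      omega
    have hevensum : ∑ r ∈ Finset.range (2 * N + 1),
        (z ^ (2 * (r + 1)) + z⁻¹ ^ (2 * (r + 1))) = -2 := by
      rw [Finset.sum_add_distrib, hpos, hneg]
      norm_num
    rw [Multiset.map_add, Multiset.sum_add, Multiset.map_nsmul, Multiset.sum_nsmul,
      Multiset.map_map, Multiset.map_nsmul, Multiset.sum_nsmul, Multiset.map_map]
    simp only [Function.comp_def, hoddterm]
    rw [show (Multiset.map _ (Multiset.range (N + 1))).sum = (0 : ℂ) from hoddsum,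
      show (Multiset.map _ (Multiset.range (2 * N + 1))).sum = (-2 : ℂ) from hevensum, hN]
    have ha : (a : ℂ) = 2 * (a / 2 : ℕ) + (a % 2 : ℕ) := by
      exact_mod_cast (Nat.div_add_mod a 2).symm
    simp
    rw [ha]
    ring

lemma exists_exponents_prime {q t k s : ℕ} (hq : q.Prime) (ht : 0 < t) (hdvd : q ^ t ∣ s)
    (hs : s ≤ 2 * k + s / q ^ t) :
    ∃ x : Fin k → ℕ, ∀ i < t, ∀ z : ℂ, IsPrimitiveRoot z (q ^ (i + 2)) →
      (s - 2 * k : ℂ) + ∑ j, (z ^ x j + z⁻¹ ^ x j) = 0 := by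
  obtain ⟨a, rfl⟩ := hdvd
  rw [Nat.mul_div_cancel_left _ (pow_pos hq.pos t)] at hs
  rw [mul_comm] at hs ⊢
  obtain ⟨L, hcard, hL⟩ : ∃ L, HasVanishingExponents (a * q ^ t) k q t L := by
    rcases hq.eq_two_or_odd' with rfl | hodd
    · exact exists_hasVanishingExponents_two ht hs
    · exact exists_hasVanishingExponents_odd hq hodd hs
  obtain ⟨L, rfl⟩ := Quot.exists_rep L
  obtain rfl : L.length = k := hcard
  refine ⟨L.get, fun i hi z hz => ?_⟩
  rw [← hL i hi z hz]
  congr 1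
  change _ = (L.map fun n => z ^ n + z⁻¹ ^ n).sum
  rw [← List.sum_ofFn]
  congr 1
  conv_rhs => rw [← List.ofFn_get L, List.map_ofFn]
  rfl

lemma exists_exponents {k s D : ℕ} (hD : D ∣ s) (hD0 : D ≠ 0)
    (hs : ∀ q t : ℕ, q.Prime → 0 < t → q ^ t ∣ D → s ≤ 2 * k + s / q ^ t) :
    ∃ l : Fin k → ℕ, ∀ q, q.Prime → ∀ i < D.factorization q, ∀ z : ℂ,
      IsPrimitiveRoot z (q ^ (i + 2)) →
        (s - 2 * k : ℂ) + ∑ j, (z ^ l j + z⁻¹ ^ l j) = 0 := by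
  have hloc : ∀ q, ∃ x : Fin k → ℕ, q ∈ D.primeFactors → ∀ i < D.factorization q, ∀ z : ℂ,
      IsPrimitiveRoot z (q ^ (i + 2)) →
        (s - 2 * k : ℂ) + ∑ j, (z ^ x j + z⁻¹ ^ x j) = 0 := by
    intro q
    by_cases hq : q ∈ D.primeFactors
    · have hp := Nat.prime_of_mem_primeFactors hq
      have ht : 0 < D.factorization q :=
        hp.factorization_pos_of_dvd hD0 (Nat.dvd_of_mem_primeFactors hq)
      have hd := Nat.ordProj_dvd D q
      obtain ⟨x, hx⟩ := exists_exponents_prime hp ht (hd.trans hD) (hs q _ hp ht hd)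
      exact ⟨x, fun _ => hx⟩
    · exact ⟨0, fun h => absurd h hq⟩
  choose x hx using hloc
  have hcrt : ∀ j, ∃ n, ∀ q ∈ D.primeFactors, n ≡ x q j [MOD q ^ (D.factorization q + 1)] := by
    intro j
    obtain ⟨n, hn⟩ := Nat.chineseRemainderOfFinset (fun q => x q j)
      (fun q => q ^ (D.factorization q + 1)) D.primeFactors
      (fun q hq => pow_ne_zero _ (Nat.prime_of_mem_primeFactors hq).ne_zero)
      (fun p hp q hq hpq => Nat.coprime_pow_primes _ _ (Nat.prime_of_mem_primeFactors hp)
        (Nat.prime_of_mem_primeFactors hq) hpq)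
    exact ⟨n, hn⟩
  choose l hl using hcrt
  refine ⟨l, fun q hq i hi z hz => ?_⟩
  have hqD : q ∈ D.primeFactors := by
    rw [← Nat.support_factorization, Finsupp.mem_support_iff]
    omega
  have hmod : ∀ j, l j ≡ x q j [MOD q ^ (i + 2)] := fun j =>
    (hl j q hqD).of_dvd (pow_dvd_pow q (by omega))
  have hpow : ∀ w : ℂ, IsPrimitiveRoot w (q ^ (i + 2)) → ∀ j, w ^ l j = w ^ x q j := by
    intro w hw j
    rw [pow_eq_pow_mod (l j) hw.pow_eq_one, hmod j, ← pow_eq_pow_mod _ hw.pow_eq_one]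
  simpa only [hpow z hz, hpow z⁻¹ hz.inv] using hx q hqD i hi z hz

/-- If `U` is divisible by a factor `F` of `1 + x + ⋯ + x^{P-1}` with `U(1) = g F(1)`, then `U`
has an `m`-multitiling for every multiple `m` of `g`. -/
lemma exists_isMultitiling_of_dvd {P k : ℕ} [NeZero P] {l : Fin k → ℕ} {b c : ℕ} {F : ℤ[X]}
    (hFU : F ∣ polyA k l b c) (hFG : F ∣ ∑ i ∈ Finset.range P, X ^ i) {g m : ℤ}
    (hF : (b : ℤ) + c = g * eval 1 F) (hm : g ∣ m) :
    ∃ v, IsMultitiling P (tileU P k l b c) v m := by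
  obtain ⟨W, hW⟩ := hFU
  obtain ⟨V, hV⟩ := hFG
  obtain ⟨e, rfl⟩ := hm
  have hG : eval 1 F * eval 1 V = P := by
    rw [← eval_mul, ← hV]
    simp [eval_finsetSum]
  have hF0 : eval 1 F ≠ 0 := left_ne_zero_of_mul (hG ▸ Nat.cast_ne_zero.mpr (NeZero.ne P))
  have hW1 : eval 1 W = g := by
    have := eval_one_polyA k l b c
    rw [hW, hF, eval_mul, mul_comm] at this
    exact mul_right_cancel₀ hF0 this
  have hones : aeval (shift P) (∑ i ∈ Finset.range P, (X : ℤ[X]) ^ i) (Pi.single 0 1) = 1 := by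
    funext h
    have := sum_range_natCast_zmod P (fun a => (Pi.single 0 1 : ZMod P → ℤ) (h - a))
    simp only [map_sum, map_pow, aeval_X, LinearMap.sum_apply, Finset.sum_apply,
      shift_pow_apply]
    rw [this]
    simp [Pi.single_apply, sub_eq_zero]
  have hconst : ∀ Q : ℤ[X], aeval (shift P) Q 1 = eval 1 Q • 1 := by
    intro Q
    induction Q using Polynomial.induction_on' with
    | add p q hp hq => rw [map_add, LinearMap.add_apply, hp, hq, eval_add, add_smul]
    | monomial n a =>
      funext h
      rw [aeval_monomial, Module.End.mul_apply, Module.algebraMap_end_apply, Pi.smul_apply,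
        shift_pow_apply]
      simp
  refine ⟨aeval (shift P) (C e * V) (Pi.single 0 1), ?_⟩
  rw [isMultitiling_tileU_iff]
  intro h
  rw [← Module.End.mul_apply, ← map_mul,
    show polyA k l b c * (C e * V) = (C e * W) * (∑ i ∈ Finset.range P, X ^ i) by
      rw [hV, hW]; ring,
    map_mul, Module.End.mul_apply, hones, hconst]
  simp [hW1, mul_comm]

/-- The orders `q^2, …, q^{t+1}`, where `q` runs over the primes dividing `D` and `q^t ∥ D`. -/
def shiftedPrimePowers (D : ℕ) : Finset ℕ :=
  (D.primeFactors.sigma fun q => Finset.range (D.factorization q)).image fun x => x.1 ^ (x.2 + 2)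

lemma mem_shiftedPrimePowers {D n : ℕ} : n ∈ shiftedPrimePowers D ↔
    ∃ q, q.Prime ∧ ∃ i < D.factorization q, q ^ (i + 2) = n := by
  simp only [shiftedPrimePowers, Finset.mem_image, Finset.mem_sigma, Finset.mem_range]
  constructor
  · rintro ⟨x, ⟨h1, h2⟩, rfl⟩
    exact ⟨x.1, Nat.prime_of_mem_primeFactors h1, x.2, h2, rfl⟩
  · rintro ⟨q, -, i, hi, rfl⟩
    refine ⟨⟨q, i⟩, ⟨?_, hi⟩, rfl⟩
    change q ∈ D.primeFactors
    rw [← Nat.support_factorization, Finsupp.mem_support_iff]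
    omega

lemma eval_one_prod_shiftedPrimePowers {D : ℕ} (hD : D ≠ 0) :
    eval 1 (∏ n ∈ shiftedPrimePowers D, cyclotomic n ℤ) = D := by
  rw [shiftedPrimePowers, Finset.prod_image, Finset.prod_sigma, eval_prod]
  · conv_rhs => rw [← Nat.prod_factorization_pow_eq_self hD, Finsupp.prod,
      Nat.support_factorization]
    push_cast
    refine Finset.prod_congr rfl fun q hq => ?_
    have := Fact.mk (Nat.prime_of_mem_primeFactors hq)
    rw [eval_prod, Finset.prod_congr rfl fun i _ => eval_one_cyclotomic_prime_pow (i + 1),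
      Finset.prod_const, Finset.card_range]
  · rintro ⟨p, i⟩ hp ⟨q, j⟩ hq h
    simp only [Finset.coe_sigma, Set.mem_sigma_iff, Finset.mem_coe] at hp hq
    obtain ⟨rfl, hij⟩ := (Nat.prime_of_mem_primeFactors hp.1).pow_inj
      (Nat.prime_of_mem_primeFactors hq.1) (m := i + 1) (n := j + 1) h
    obtain rfl := Nat.succ_injective hij
    rfl

lemma exists_isMultitiling {k b c : ℕ} (hb : 0 < b) (hc : 0 < c)
    (h : ∀ q t : ℕ, q.Prime → 0 < t → q ^ t ∣ (b + c) / Nat.gcd b c →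
        b + c ≤ 2 * k + (b + c) / q ^ t) :
    ∃ (l : Fin k → ℕ) (P : ℕ), 1 < P ∧
      ∃ v : ZMod P → ℤ, IsMultitiling P (tileU P k l b c) v (c : ℤ) := by
  set g := Nat.gcd b c
  have hg : 0 < g := Nat.gcd_pos_of_pos_right b hc
  have hgs : g ∣ b + c := Nat.dvd_add (Nat.gcd_dvd_left b c) (Nat.gcd_dvd_right b c)
  set D := (b + c) / g
  have hD : b + c = g * D := (Nat.mul_div_cancel' hgs).symm
  have hD1 : 1 < D := by
    have := Nat.gcd_le_left c hb
    by_contra! hle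
    have := Nat.mul_le_mul_left g hle
    omega
  obtain ⟨l, hl⟩ := exists_exponents (Dvd.intro_left g hD.symm) (by omega) h
  have hP : 1 < D ^ 2 := Nat.one_lt_pow two_ne_zero hD1
  have : NeZero (D ^ 2) := ⟨by omega⟩
  have hpos : ∀ n ∈ shiftedPrimePowers D, 0 < n := by
    intro n hn
    obtain ⟨q, hq, i, -, rfl⟩ := mem_shiftedPrimePowers.1 hn
    exact pow_pos hq.pos _
  refine ⟨l, D ^ 2, hP, exists_isMultitiling_of_dvd (g := g)
    (F := ∏ n ∈ shiftedPrimePowers D, cyclotomic n ℤ) (prod_cyclotomic_dvd hpos ?_) ?_ ?_ ?_⟩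
  · intro n hn
    obtain ⟨q, hq, i, hi, rfl⟩ := mem_shiftedPrimePowers.1 hn
    have hz := Complex.isPrimitiveRoot_exp _ (hpos _ hn).ne'
    rw [cyclotomic_dvd_polyA_iff (hpos _ hn) hz]
    simpa [symSum] using hl q hq i hi _ hz
  · rw [← prod_cyclotomic_eq_geom_sum (NeZero.pos (D ^ 2))]
    refine Finset.prod_dvd_prod_of_subset _ _ _ fun n hn => ?_
    obtain ⟨q, hq, i, hi, rfl⟩ := mem_shiftedPrimePowers.1 hn
    rw [Finset.mem_erase, Nat.mem_divisors]
    refine ⟨(Nat.one_lt_pow (by omega) hq.one_lt).ne', ?_, NeZero.ne _⟩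
    refine (pow_dvd_pow q (n := D.factorization q * 2) (by omega)).trans ?_
    rw [pow_mul]
    exact pow_dvd_pow_of_dvd (Nat.ordProj_dvd D q) 2
  · rw [eval_one_prod_shiftedPrimePowers (by omega)]
    exact_mod_cast hD
  · exact_mod_cast Nat.gcd_dvd_right b c

/-- There exist distances `l_1,...,l_k` and `P > 1` with a `c`-multitiling of `ℤ/Pℤ` with
tile `u_{l_1,...,l_k;b,c;P}` if and only if `b + c ≤ 2k + (b+c)/q^t` for every prime `q`
and positive integer `t` with `q^t ∣ (b+c)/gcd(b,c)`. -/
theorem stmt10 (k : ℕ) (hk : 1 ≤ k) (b c : ℕ) (hb : 0 < b) (hc : 0 < c) :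
    (∃ (l : Fin k → ℕ) (P : ℕ), 1 < P ∧
        ∃ v : ZMod P → ℤ, IsMultitiling P (tileU P k l b c) v (c : ℤ)) ↔
      (∀ q t : ℕ, q.Prime → 0 < t → q ^ t ∣ (b + c) / Nat.gcd b c →
        b + c ≤ 2 * k + (b + c) / q ^ t) := by
  exact ⟨fun ⟨_, _, hP, _, hv⟩ _ _ hq _ hqt => hv.add_le hP hc hq hqt,
    exists_isMultitiling hb hc⟩
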